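/- Let α, β > −1 be real and n ≥ 1 an integer. With r = 2, define q_n(x; α, β) = p_n(x; α, β−1), ν_{n,1}(α,β) = Γ(n+α+(β+n)/2+1) / (Γ(n+α+1) Γ((β+n)/2+1)), ν_{n,2}(α,β) = Γ(n+α+(β+n+1)/2) / (Γ(n+α+1) Γ((β+n+1)/2)), and γ_n(α,β) = 2 n! ν_{n,1}(α,β) / (2n+2α+β+1)_{n+1}. Define B_{n+1,n}(x) = [ν_{n,1}(α,β) q_n(x;α,β) − ν_{n,2}(α,β) p_n(x;α,β)] / γ_n(α,β), B_{n,n+1}(x) = [ν_{n,1}(α,β) q_n(x;α,β) + ν_{n,2}(α,β) p_n(x;α,β)] / γ_n(α,β), A_{n+1,n}(x) = B_{n,n+1}(−x) and A_{n,n+1}(x) = B_{n+1,n}(−x). Then for every integer k with 0 ≤ k ≤ 2n−1 one has ∫_{−1}^{0} x^k A_{n+1,n}(x) |x|^β (1−x^2)^α dx + ∫_{0}^{1} x^k B_{n+1,n}(x) x^β (1−x^2)^α dx = 0 and ∫_{−1}^{0} x^k A_{n,n+1}(x) |x|^β (1−x^2)^α dx + ∫_{0}^{1} x^k B_{n,n+1}(x)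 x^β (1−x^2)^α dx = 0, while for k = 2n each of these two sums of integrals equals 1. -/

import Mathlib

/-- The polynomial p_n(x; α, β), here used with r = 2. -/
noncomputable def jacAng (r n : ℕ) (α β x : ℝ) : ℝ :=
  ∑ k ∈ Finset.range (n + 1), (n.choose k : ℝ) *
    (Real.Gamma (n + α + (β + k) / r + 1) /
      (Real.Gamma (n + α + 1) * Real.Gamma ((β + k) / r + 1))) *
    (-1) ^ (n - k) * x ^ k

/-- The Pochhammer symbol (a)_m = Γ(a+m)/Γ(a). -/
noncomputable def poch (a : ℝ) (m : ℕ) : ℝ := Real.Gamma (a + m) / Real.Gamma a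

/-- q_n(x; α, β) = p_n(x; α, β−1) with r = 2. -/
noncomputable def jacAngQ (n : ℕ) (α β x : ℝ) : ℝ := jacAng 2 n α (β - 1) x

/-- ν_{n,1}(α,β), the leading coefficient of p_n(x; α, β). -/
noncomputable def nu1 (n : ℕ) (α β : ℝ) : ℝ :=
  Real.Gamma (n + α + (β + n) / 2 + 1) /
    (Real.Gamma (n + α + 1) * Real.Gamma ((β + n) / 2 + 1))

/-- ν_{n,2}(α,β), the leading coefficient of q_n(x; α, β). -/
noncomputable def nu2 (n : ℕ) (α β : ℝ) : ℝ :=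
  Real.Gamma (n + α + (β + n + 1) / 2) /
    (Real.Gamma (n + α + 1) * Real.Gamma ((β + n + 1) / 2))

/-- γ_n(α,β) = 2 n! ν_{n,1}(α,β) / (2n+2α+β+1)_{n+1}. -/
noncomputable def gam (n : ℕ) (α β : ℝ) : ℝ :=
  2 * n.factorial * nu1 n α β / poch (2 * n + 2 * α + β + 1) (n + 1)

/-- B_{n+1,n}. -/
noncomputable def Bdown (n : ℕ) (α β x : ℝ) : ℝ :=
  (nu1 n α β * jacAngQ n α β x - nu2 n α β * jacAng 2 n α β x) / gam n α β

/-- B_{n,n+1}. -/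
noncomputable def Bup (n : ℕ) (α β x : ℝ) : ℝ :=
  (nu1 n α β * jacAngQ n α β x + nu2 n α β * jacAng 2 n α β x) / gam n α β

/-- A_{n+1,n}(x) = B_{n,n+1}(−x). -/
noncomputable def Adown (n : ℕ) (α β x : ℝ) : ℝ := Bup n α β (-x)

/-- A_{n,n+1}(x) = B_{n+1,n}(−x). -/
noncomputable def Aup (n : ℕ) (α β x : ℝ) : ℝ := Bdown n α β (-x)

lemma Real.Gamma_add_nat_eq_ascPochhammer_mul {x : ℝ} (hx : 0 < x) (n : ℕ) :
    Real.Gamma (x + n) = (ascPochhammer ℝ n).eval x * Real.Gamma x := by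
  induction n with
  | zero => simp
  | succ n ih =>
    rw [Nat.cast_succ, ← add_assoc, Real.Gamma_add_one (by positivity), ih,
      ascPochhammer_succ_eval]
    ring

lemma poch_eq_ascPochhammer_eval {a : ℝ} (ha : 0 < a) (m : ℕ) :
    poch a m = (ascPochhammer ℝ m).eval a := by
  rw [poch, Real.Gamma_add_nat_eq_ascPochhammer_mul ha,
    mul_div_cancel_right₀ _ (Real.Gamma_pos_of_pos ha).ne']

/-- Alternating binomial sums annihilate polynomials of degree less than `n`. -/
lemma sum_choose_mul_eval_eq_zero {n : ℕ} {P : Polynomial ℝ} (hP : P.natDegree < n) :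
    ∑ j ∈ Finset.range (n + 1), (n.choose j : ℝ) * (-1) ^ (n - j) * P.eval (j : ℝ) = 0 := by
  have h := congr_fun (Polynomial.fwdDiff_iter_eq_zero_of_degree_lt hP) 0
  rw [fwdDiff_iter_eq_sum_shift] at h
  simp only [zero_add, nsmul_eq_mul, mul_one, zsmul_eq_mul, Pi.zero_apply] at h
  rw [← h]
  refine Finset.sum_congr rfl fun j _ => ?_
  push_cast
  ring

lemma fwdDiff_iter_inv {y : ℝ} (hy : 0 < y) (n : ℕ) :
    (fwdDiff 1)^[n] (fun x : ℝ => x⁻¹) y =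
      (-1) ^ n * n.factorial / (ascPochhammer ℝ (n + 1)).eval y := by
  induction n generalizing y with
  | zero => simp
  | succ n ih =>
    have h0 := ascPochhammer_pos n (y + 1) (by positivity)
    have hl (m : ℕ) : (ascPochhammer ℝ (m + 1)).eval y =
        y * (ascPochhammer ℝ m).eval (y + 1) := by
      simp [ascPochhammer_succ_left]
    rw [Function.iterate_succ_apply', fwdDiff, ih hy, ih (by positivity), hl (n + 1), hl n,
      ascPochhammer_succ_eval, Nat.factorial_succ]
    have : y + 1 + n ≠ 0 := by positivity
    push_cast
    field_simp
    ring

lemma sum_choose_div_add {y : ℝ} (hy : 0 < y) (n : ℕ) :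
    ∑ j ∈ Finset.range (n + 1), (n.choose j : ℝ) * (-1) ^ (n - j) * (y + j)⁻¹ =
      (-1) ^ n * n.factorial / (ascPochhammer ℝ (n + 1)).eval y := by
  rw [← fwdDiff_iter_inv hy, fwdDiff_iter_eq_sum_shift]
  refine Finset.sum_congr rfl fun j _ => ?_
  simp only [nsmul_eq_mul, mul_one, zsmul_eq_mul]
  push_cast
  ring

lemma ascPochhammer_eval_neg_add (n : ℕ) (a : ℝ) :
    (ascPochhammer ℝ n).eval (-(n + a)) = (-1) ^ n * (ascPochhammer ℝ n).eval (a + 1) := by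
  rw [ascPochhammer_eval_neg_eq_descPochhammer, descPochhammer_eval_eq_ascPochhammer]
  ring_nf

lemma sum_choose_ascPochhammer_div {n : ℕ} (hn : 1 ≤ n) {c a : ℝ}
    (hca : 0 < c + (n + a)) :
    ∑ j ∈ Finset.range (n + 1), (n.choose j : ℝ) * (-1) ^ (n - j) *
      ((ascPochhammer ℝ n).eval (c + j / 2) / (c + j / 2 + (n + a))) =
      2 * n.factorial * (ascPochhammer ℝ n).eval (a + 1) /
        (ascPochhammer ℝ (n + 1)).eval (2 * (c + (n + a))) := by
  set A := ascPochhammer ℝ n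
  set R := A /ₘ (Polynomial.X - Polynomial.C (-(n + a)))
  have hdiv (x : ℝ) : A.eval x = (-1) ^ n * A.eval (a + 1) + (x + (n + a)) * R.eval x := by
    have h := congr_arg (Polynomial.eval x)
      (Polynomial.modByMonic_add_div A (Polynomial.X - Polynomial.C (-(n + a))))
    rw [Polynomial.modByMonic_X_sub_C_eq_C_eval, ascPochhammer_eval_neg_add] at h
    simp only [Polynomial.eval_add, Polynomial.eval_mul, Polynomial.eval_sub, Polynomial.eval_C,
      Polynomial.eval_X, sub_neg_eq_add] at h
    exact h.symm
  have hR : R.natDegree < n := by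
    rw [Polynomial.natDegree_divByMonic _ (Polynomial.monic_X_sub_C _),
      Polynomial.natDegree_X_sub_C, ascPochhammer_natDegree]
    omega
  have hRcomp : (R.comp (Polynomial.C (1 / 2) * Polynomial.X + Polynomial.C c)).natDegree < n :=
    by rwa [Polynomial.natDegree_comp, Polynomial.natDegree_linear (by norm_num), mul_one]
  have hsum := sum_choose_mul_eval_eq_zero hRcomp
  have hinv := sum_choose_div_add (show 0 < 2 * (c + (n + a)) by positivity) n
  have : ∀ j ∈ Finset.range (n + 1), (n.choose j : ℝ) * (-1) ^ (n - j) *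
      (A.eval (c + j / 2) / (c + j / 2 + (n + a))) =
      2 * (-1) ^ n * A.eval (a + 1) *
        ((n.choose j : ℝ) * (-1) ^ (n - j) * (2 * (c + (n + a)) + j)⁻¹) +
      (n.choose j : ℝ) * (-1) ^ (n - j) *
        (R.comp (Polynomial.C (1 / 2) * Polynomial.X + Polynomial.C c)).eval (j : ℝ) := by
    intro j _
    have h1 : c + j / 2 + (n + a) = (2 * (c + (n + a)) + j) / 2 := by ring
    have h2 : 0 < 2 * (c + (n + a)) + j := by positivity
    have h3 : Polynomial.eval (j : ℝ) (Polynomial.C (1 / 2) * Polynomial.X + Polynomial.C c) =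
        c + j / 2 := by simp; ring
    rw [hdiv, Polynomial.eval_comp, h3, h1]
    field_simp
  rw [Finset.sum_congr rfl this, Finset.sum_add_distrib, ← Finset.mul_sum, hsum, hinv]
  have : ((-1 : ℝ) ^ n) * (-1) ^ n = 1 := by rw [← mul_pow]; simp
  linear_combination (2 * n.factorial * A.eval (a + 1) /
        (ascPochhammer ℝ (n + 1)).eval (2 * (c + (n + a)))) * this

lemma integral_rpow_mul_one_sub_rpow {s t : ℝ} (hs : 0 < s) (ht : 0 < t) :
    ∫ u in (0 : ℝ)..1, u ^ (s - 1) * (1 - u) ^ (t - 1) = ProbabilityTheory.beta s t := by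
  rw [ProbabilityTheory.beta_eq_betaIntegralReal s t hs ht, Complex.betaIntegral,
    ← Complex.ofReal_re (∫ u in (0 : ℝ)..1, u ^ (s - 1) * (1 - u) ^ (t - 1)),
    ← intervalIntegral.integral_ofReal]
  congr 1
  refine intervalIntegral.integral_congr fun x hx => ?_
  rw [Set.uIcc_of_le zero_le_one] at hx
  have := hx.1
  have : 0 ≤ 1 - x := sub_nonneg.2 hx.2
  push_cast [Complex.ofReal_cpow, *]
  rfl

/-- The beta integral after the substitution `u = x ^ 2`. -/
lemma integral_rpow_mul_one_sub_sq_rpow {a α : ℝ} (ha : -1 < a) (hα : -1 < α) :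
    ∫ x in (0 : ℝ)..1, x ^ a * (1 - x ^ 2) ^ α =
      ProbabilityTheory.beta ((a + 1) / 2) (α + 1) / 2 := by
  rw [← integral_rpow_mul_one_sub_rpow (by linarith) (by linarith),
    intervalIntegral.integral_of_le zero_le_one, intervalIntegral.integral_of_le zero_le_one]
  have hind (f : ℝ → ℝ) : ∫ x in Set.Ioc (0 : ℝ) 1, f x =
      ∫ x in Set.Ioi (0 : ℝ), (Set.Iic 1).indicator f x := by
    rw [MeasureTheory.setIntegral_indicator measurableSet_Iic, Set.Ioi_inter_Iic]
  rw [hind, hind, ← MeasureTheory.integral_comp_rpow_Ioi_of_pos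
      (g := (Set.Iic 1).indicator fun u : ℝ => u ^ ((a + 1) / 2 - 1) * (1 - u) ^ (α + 1 - 1))
      (show (0 : ℝ) < 2 by norm_num),
    ← MeasureTheory.integral_div]
  refine MeasureTheory.setIntegral_congr_fun measurableSet_Ioi fun x hx => ?_
  rw [Set.mem_Ioi] at hx
  have hmem : x ^ (2 : ℝ) ≤ 1 ↔ x ≤ 1 := by
    rw [Real.rpow_two, sq_le_one_iff₀ hx.le]
  simp only [Set.indicator, Set.mem_Iic, hmem, smul_eq_mul]
  split_ifs
  · have h : x ^ a = x * x ^ (2 * ((a + 1) / 2 - 1)) := by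
      nth_rw 2 [← Real.rpow_one x]
      rw [← Real.rpow_add hx]
      ring_nf
    rw [← Real.rpow_mul hx.le, Real.rpow_two, h, add_sub_cancel_right]
    norm_num
    ring
  · simp

lemma intervalIntegrable_rpow_mul_one_sub_sq_rpow {a α : ℝ} (ha : -1 < a) (hα : -1 < α) :
    IntervalIntegrable (fun x : ℝ => x ^ a * (1 - x ^ 2) ^ α) MeasureTheory.volume 0 1 := by
  by_contra h
  have h1 := integral_rpow_mul_one_sub_sq_rpow ha hα
  have h2 := ProbabilityTheory.beta_pos (show 0 < (a + 1) / 2 by linarith)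
    (show 0 < α + 1 by linarith)
  rw [intervalIntegral.integral_undef h] at h1
  linarith

lemma continuous_jacAng (r n : ℕ) (α β : ℝ) : Continuous (jacAng r n α β) := by
  unfold jacAng
  fun_prop

/-- The moments of `p_n(x; α, b)` against `x ^ (b + 1 + 2m) (1 - x²) ^ α`. -/
lemma integral_jacAng {n : ℕ} {α b : ℝ} (hα : -1 < α) (hb : -2 < b) (m : ℕ) :
    ∫ x in (0 : ℝ)..1, jacAng 2 n α b x * (x ^ (b + 1 + 2 * m) * (1 - x ^ 2) ^ α) =
      Real.Gamma (α + 1) / (2 * Real.Gamma (n + α + 1)) *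
        ∑ j ∈ Finset.range (n + 1), (n.choose j : ℝ) * (-1) ^ (n - j) *
          ((ascPochhammer ℝ m).eval ((b / 2 + 1) + j / 2) *
            (Real.Gamma ((b / 2 + 1) + j / 2 + n + α) /
              Real.Gamma ((b / 2 + 1) + j / 2 + m + α + 1))) := by
  have hexp (j : ℕ) : -1 < b + 1 + 2 * (m : ℝ) + j := by
    have : (0 : ℝ) ≤ 2 * m + j := by positivity
    linarith
  simp only [jacAng, Finset.sum_mul]
  rw [Finset.mul_sum]
  have hcongr : ∀ j : ℕ, Set.EqOn
      (fun x : ℝ => (n.choose j : ℝ) * (Real.Gamma (n + α + (b + j) / (2 : ℕ) + 1) /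
        (Real.Gamma (n + α + 1) * Real.Gamma ((b + j) / (2 : ℕ) + 1))) *
        (-1) ^ (n - j) * x ^ j * (x ^ (b + 1 + 2 * m) * (1 - x ^ 2) ^ α))
      (fun x : ℝ => (n.choose j : ℝ) * (Real.Gamma (n + α + (b + j) / (2 : ℕ) + 1) /
        (Real.Gamma (n + α + 1) * Real.Gamma ((b + j) / (2 : ℕ) + 1))) *
        (-1) ^ (n - j) * (x ^ (b + 1 + 2 * m + j) * (1 - x ^ 2) ^ α)) (Set.uIoc 0 1) := by
    intro j x hx
    rw [Set.uIoc_of_le zero_le_one] at hx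
    simp only
    rw [Real.rpow_add_natCast hx.1.ne']
    ring
  rw [intervalIntegral.integral_finsetSum fun j _ =>
    ((intervalIntegrable_rpow_mul_one_sub_sq_rpow (hexp j) hα).const_mul _).congr
      (hcongr j).symm]
  refine Finset.sum_congr rfl fun j _ => ?_
  rw [intervalIntegral.integral_congr_ae (.of_forall fun x hx => hcongr j hx), intervalIntegral.integral_const_mul,
    integral_rpow_mul_one_sub_sq_rpow (hexp j) hα, ProbabilityTheory.beta]
  have hc : 0 < b / 2 + 1 + j / 2 := by
    have : (0 : ℝ) ≤ j := by positivity
    linarith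
  have e1 : (n : ℝ) + α + (b + j) / (2 : ℕ) + 1 = b / 2 + 1 + j / 2 + n + α := by
    push_cast; ring
  have e2 : (b + j) / (2 : ℕ) + 1 = b / 2 + 1 + j / 2 := by push_cast; ring
  have e3 : (b + 1 + 2 * m + j + 1) / 2 = b / 2 + 1 + j / 2 + m := by ring
  rw [e1, e2, e3, Real.Gamma_add_nat_eq_ascPochhammer_mul hc,
    ← add_assoc (b / 2 + 1 + j / 2 + (m : ℝ))]
  generalize b / 2 + 1 + (j : ℝ) / 2 = c at hc
  have := (Real.Gamma_pos_of_pos hc).ne'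
  field_simp

lemma integral_jacAng_eq_zero {n m : ℕ} (hm : m < n) {α b : ℝ} (hα : -1 < α) (hb : -2 < b) :
    ∫ x in (0 : ℝ)..1, jacAng 2 n α b x * (x ^ (b + 1 + 2 * m) * (1 - x ^ 2) ^ α) = 0 := by
  rw [integral_jacAng hα hb]
  refine mul_eq_zero_of_right _ ?_
  obtain ⟨l, rfl⟩ := Nat.exists_eq_add_of_lt hm
  set P : Polynomial ℝ :=
    (ascPochhammer ℝ m).comp (Polynomial.C (1 / 2) * Polynomial.X + Polynomial.C (b / 2 + 1)) *
    (ascPochhammer ℝ l).comp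
      (Polynomial.C (1 / 2) * Polynomial.X + Polynomial.C (b / 2 + 1 + m + α + 1))
  have hlin (c : ℝ) (k : ℕ) : ((ascPochhammer ℝ k).comp
      (Polynomial.C (1 / 2) * Polynomial.X + Polynomial.C c)).natDegree = k := by
    rw [Polynomial.natDegree_comp, Polynomial.natDegree_linear (by norm_num),
      ascPochhammer_natDegree, mul_one]
  have hP : P.natDegree < m + l + 1 := by
    refine Nat.lt_succ_of_le (Polynomial.natDegree_mul_le.trans ?_)
    rw [hlin, hlin]
  rw [← sum_choose_mul_eval_eq_zero hP]
  refine Finset.sum_congr rfl fun j _ => ?_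
  have hc : 0 < b / 2 + 1 + j / 2 + m + α + 1 := by
    have : (0 : ℝ) ≤ j / 2 + m := by positivity
    linarith
  have e : b / 2 + 1 + (j : ℝ) / 2 + (m + l + 1 : ℕ) + α =
      b / 2 + 1 + j / 2 + m + α + 1 + l := by push_cast; ring
  rw [e, Real.Gamma_add_nat_eq_ascPochhammer_mul hc,
    mul_div_cancel_right₀ _ (Real.Gamma_pos_of_pos hc).ne']
  simp only [P, Polynomial.eval_mul, Polynomial.eval_comp, Polynomial.eval_add,
    Polynomial.eval_C, Polynomial.eval_X]
  ring_nf

lemma integral_jacAng_self {n : ℕ} (hn : 1 ≤ n) {α b : ℝ} (hα : -1 < α) (hb : -2 < b) :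
    ∫ x in (0 : ℝ)..1, jacAng 2 n α b x * (x ^ (b + 1 + 2 * n) * (1 - x ^ 2) ^ α) =
      n.factorial / poch (2 * n + 2 * α + b + 2) (n + 1) := by
  have hn' : (1 : ℝ) ≤ n := by exact_mod_cast hn
  have hpos : 0 < b / 2 + 1 + (n + α) := by linarith
  have hG : Real.Gamma (n + α + 1) =
      (ascPochhammer ℝ n).eval (α + 1) * Real.Gamma (α + 1) := by
    rw [← Real.Gamma_add_nat_eq_ascPochhammer_mul (by linarith)]
    ring_nf
  have hsum := sum_choose_ascPochhammer_div hn hpos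
  rw [integral_jacAng hα hb, poch_eq_ascPochhammer_eval (by linarith)]
  have : ∀ j ∈ Finset.range (n + 1), (n.choose j : ℝ) * (-1) ^ (n - j) *
      ((ascPochhammer ℝ n).eval ((b / 2 + 1) + j / 2) *
        (Real.Gamma ((b / 2 + 1) + j / 2 + n + α) /
          Real.Gamma ((b / 2 + 1) + j / 2 + n + α + 1))) =
      (n.choose j : ℝ) * (-1) ^ (n - j) *
      ((ascPochhammer ℝ n).eval (b / 2 + 1 + j / 2) / (b / 2 + 1 + j / 2 + (n + α))) := by
    intro j _
    have hc : 0 < b / 2 + 1 + j / 2 + n + α := by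
      have : (0 : ℝ) ≤ j / 2 := by positivity
      linarith
    rw [Real.Gamma_add_one hc.ne', ← add_assoc, div_mul_cancel_right₀ (Real.Gamma_pos_of_pos hc).ne',
      ← div_eq_mul_inv]
  rw [Finset.sum_congr rfl this, hsum, hG]
  have h1 := Real.Gamma_pos_of_pos (show 0 < α + 1 by linarith)
  have h2 := ascPochhammer_pos n (α + 1) (by linarith)
  rw [show 2 * (b / 2 + 1 + (n + α)) = 2 * n + 2 * α + b + 2 by ring]
  field_simp

/-- The moments of `p_n(x; α, b)` with respect to the weight `x ^ β (1 - x²) ^ α`. -/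
noncomputable def jacAngMoment (n : ℕ) (α β b : ℝ) (k : ℕ) : ℝ :=
  ∫ x in (0 : ℝ)..1, x ^ k * jacAng 2 n α b x * x ^ β * (1 - x ^ 2) ^ α

lemma jacAngMoment_eq {n k m : ℕ} {α β b : ℝ} (h : β + k = b + 1 + 2 * m) :
    jacAngMoment n α β b k =
      ∫ x in (0 : ℝ)..1, jacAng 2 n α b x * (x ^ (b + 1 + 2 * m) * (1 - x ^ 2) ^ α) := by
  refine intervalIntegral.integral_congr_ae (.of_forall fun x hx => ?_)
  rw [Set.uIoc_of_le zero_le_one] at hx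
  rw [← h, Real.rpow_add_natCast hx.1.ne']
  ring

lemma integral_pow_mul_jacAng_add {n : ℕ} {α β : ℝ} (hα : -1 < α) (hβ : -1 < β)
    (u v g b₁ b₂ : ℝ) (k : ℕ) :
    ∫ x in (0 : ℝ)..1, x ^ k * ((u * jacAng 2 n α b₁ x + v * jacAng 2 n α b₂ x) / g) *
        x ^ β * (1 - x ^ 2) ^ α =
      (u * jacAngMoment n α β b₁ k + v * jacAngMoment n α β b₂ k) / g := by
  have hint (b : ℝ) : IntervalIntegrable
      (fun x : ℝ => x ^ k * jacAng 2 n α b x * x ^ β * (1 - x ^ 2) ^ α)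
      MeasureTheory.volume 0 1 := by
    simp only [mul_assoc]
    simp only [← mul_assoc (_ ^ k)]
    exact (intervalIntegrable_rpow_mul_one_sub_sq_rpow hβ hα).continuousOn_mul
      ((continuous_pow k).mul (continuous_jacAng 2 n α b)).continuousOn
  rw [jacAngMoment, jacAngMoment, ← intervalIntegral.integral_const_mul,
    ← intervalIntegral.integral_const_mul,
    ← intervalIntegral.integral_add ((hint b₁).const_mul u) ((hint b₂).const_mul v),
    ← intervalIntegral.integral_div]
  congr 1 with x
  ring

lemma integral_neg_one_zero_comp_neg (f : ℝ → ℝ) (α β : ℝ) (k : ℕ) :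
    ∫ x in (-1 : ℝ)..0, x ^ k * f (-x) * |x| ^ β * (1 - x ^ 2) ^ α =
      (-1) ^ k * ∫ x in (0 : ℝ)..1, x ^ k * f x * x ^ β * (1 - x ^ 2) ^ α := by
  have h := intervalIntegral.integral_comp_neg (a := 0) (b := 1)
    (fun x : ℝ => x ^ k * f (-x) * |x| ^ β * (1 - x ^ 2) ^ α)
  rw [neg_zero] at h
  rw [← h, ← intervalIntegral.integral_const_mul]
  refine intervalIntegral.integral_congr fun x hx => ?_
  rw [Set.uIcc_of_le zero_le_one] at hx
  simp only [neg_neg, abs_neg, abs_of_nonneg hx.1, neg_sq]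
  rw [neg_pow x k]
  ring

lemma integral_Bup {n : ℕ} {α β : ℝ} (hα : -1 < α) (hβ : -1 < β) (k : ℕ) :
    ∫ x in (0 : ℝ)..1, x ^ k * Bup n α β x * x ^ β * (1 - x ^ 2) ^ α =
      (nu1 n α β * jacAngMoment n α β (β - 1) k + nu2 n α β * jacAngMoment n α β β k) /
        gam n α β :=
  integral_pow_mul_jacAng_add hα hβ _ _ _ _ _ k

lemma integral_Bdown {n : ℕ} {α β : ℝ} (hα : -1 < α) (hβ : -1 < β) (k : ℕ) :
    ∫ x in (0 : ℝ)..1, x ^ k * Bdown n α β x * x ^ β * (1 - x ^ 2) ^ α =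
      (nu1 n α β * jacAngMoment n α β (β - 1) k - nu2 n α β * jacAngMoment n α β β k) /
        gam n α β := by
  have h := integral_pow_mul_jacAng_add (n := n) hα hβ (nu1 n α β) (-nu2 n α β) (gam n α β)
    (β - 1) β k
  simp only [neg_mul, ← sub_eq_add_neg] at h
  exact h

/-- the pairs (A_{n+1,n}, B_{n+1,n}) and (A_{n,n+1}, B_{n,n+1}) are the type I
Jacobi-Angelesco polynomials near the diagonal: orthogonality for 0 ≤ k ≤ 2n−1 and
normalization for k = 2n. -/
theorem jacobiAngelesco_near_diag_typeI
    (α β : ℝ) (hα : -1 < α) (hβ : -1 < β) (n : ℕ) (hn : 1 ≤ n) :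
    (∀ k : ℕ, k ≤ 2 * n - 1 →
      ((∫ x in (-1:ℝ)..0, x ^ k * Adown n α β x * |x| ^ β * (1 - x ^ 2) ^ α) +
        ∫ x in (0:ℝ)..1, x ^ k * Bdown n α β x * x ^ β * (1 - x ^ 2) ^ α) = 0 ∧
      ((∫ x in (-1:ℝ)..0, x ^ k * Aup n α β x * |x| ^ β * (1 - x ^ 2) ^ α) +
        ∫ x in (0:ℝ)..1, x ^ k * Bup n α β x * x ^ β * (1 - x ^ 2) ^ α) = 0) ∧
    (((∫ x in (-1:ℝ)..0, x ^ (2 * n) * Adown n α β x * |x| ^ β * (1 - x ^ 2) ^ α) +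
        ∫ x in (0:ℝ)..1, x ^ (2 * n) * Bdown n α β x * x ^ β * (1 - x ^ 2) ^ α) = 1 ∧
      ((∫ x in (-1:ℝ)..0, x ^ (2 * n) * Aup n α β x * |x| ^ β * (1 - x ^ 2) ^ α) +
        ∫ x in (0:ℝ)..1, x ^ (2 * n) * Bup n α β x * x ^ β * (1 - x ^ 2) ^ α) = 1) := by
  have hsum (k : ℕ) :
      ((∫ x in (-1:ℝ)..0, x ^ k * Adown n α β x * |x| ^ β * (1 - x ^ 2) ^ α) +
        ∫ x in (0:ℝ)..1, x ^ k * Bdown n α β x * x ^ β * (1 - x ^ 2) ^ α) =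
        ((1 + (-1) ^ k) * (nu1 n α β * jacAngMoment n α β (β - 1) k) -
          (1 - (-1) ^ k) * (nu2 n α β * jacAngMoment n α β β k)) / gam n α β ∧
      ((∫ x in (-1:ℝ)..0, x ^ k * Aup n α β x * |x| ^ β * (1 - x ^ 2) ^ α) +
        ∫ x in (0:ℝ)..1, x ^ k * Bup n α β x * x ^ β * (1 - x ^ 2) ^ α) =
        ((1 + (-1) ^ k) * (nu1 n α β * jacAngMoment n α β (β - 1) k) +
          (1 - (-1) ^ k) * (nu2 n α β * jacAngMoment n α β β k)) / gam n α β := by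
    unfold Adown Aup
    rw [integral_neg_one_zero_comp_neg (Bup n α β), integral_neg_one_zero_comp_neg (Bdown n α β),
      integral_Bup hα hβ, integral_Bdown hα hβ]
    constructor <;> ring
  refine ⟨fun k hk => ?_, ?_⟩
  · rw [(hsum k).1, (hsum k).2]
    obtain ⟨m, rfl | rfl⟩ := Nat.even_or_odd' k
    · have h0 : jacAngMoment n α β (β - 1) (2 * m) = 0 := by
        rw [jacAngMoment_eq (m := m) (by push_cast; ring),
          integral_jacAng_eq_zero (by omega) hα (by linarith)]
      simp [h0]
    · have h0 : jacAngMoment n α β β (2 * m + 1) = 0 := by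
        rw [jacAngMoment_eq (m := m) (by push_cast; ring),
          integral_jacAng_eq_zero (by omega) hα (by linarith)]
      simp [h0, pow_succ]
  · rw [(hsum _).1, (hsum _).2]
    have hn' : (1 : ℝ) ≤ n := by exact_mod_cast hn
    have h0 : jacAngMoment n α β (β - 1) (2 * n) =
        n.factorial / poch (2 * n + 2 * α + β + 1) (n + 1) := by
      rw [jacAngMoment_eq (m := n) (by push_cast; ring),
        integral_jacAng_self hn hα (by linarith)]
      ring_nf
    have hnu : 0 < nu1 n α β :=
      div_pos (Real.Gamma_pos_of_pos (by linarith)) (mul_pos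
        (Real.Gamma_pos_of_pos (by linarith)) (Real.Gamma_pos_of_pos (by linarith)))
    have hpoch : 0 < poch (2 * n + 2 * α + β + 1) (n + 1) := by
      rw [poch_eq_ascPochhammer_eval (by linarith)]
      exact ascPochhammer_pos _ _ (by linarith)
    have hfac : (0 : ℝ) < n.factorial := by exact_mod_cast n.factorial_pos
    rw [h0, gam]
    generalize poch (2 * n + 2 * α + β + 1) (n + 1) = p at hpoch
    simp only [pow_mul, neg_one_sq, one_pow, sub_self, zero_mul, sub_zero, add_zero, and_self]
    field_simp
    norm_num
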